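/- Let the coefficients satisfy Hypotheses (H) and let G(t,s) be the associated evolution operator. Let {μ_t : t ≥ 0} be a tight evolution system of measures for G(t,s). Then for every s ≥ 0, every p ∈ [1,+∞) and every f ∈ C_b(ℝ^d), the quantity ∫_{ℝ^d} |G(t,s)f − m_s(f)|^p dμ_t tends to 0 as t → +∞. -/

import Mathlib

open MeasureTheory Filter Topology Metric Set
open scoped RealInnerProductSpace

noncomputable section

abbrev Ed (d : ℕ) := EuclideanSpace ℝ (Fin d)

/-- `f` belongs to `C_b(ℝ^d)`: it is bounded and continuous. -/
def IsCb {d : ℕ} (f : Ed d → ℝ) : Prop :=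
  Continuous f ∧ ∃ M, ∀ x, |f x| ≤ M

/-- The action of the operator `A(t)φ = Tr(Q(t,·)D²φ) + ⟨b(t,·),∇φ⟩`. -/
def applyA {d : ℕ} (q : ℝ → Ed d → Matrix (Fin d) (Fin d) ℝ) (b : ℝ → Ed d → Ed d)
    (t : ℝ) (u : Ed d → ℝ) (x : Ed d) : ℝ :=
  (∑ i, ∑ j, q t x i j *
      iteratedFDeriv ℝ 2 u x ![EuclideanSpace.single i 1, EuclideanSpace.single j 1]) +
    ⟪b t x, gradient u x⟫

/-- `u` is a bounded classical solution (in `C_b([s,∞)×ℝ^d) ∩ C^{1,2}((s,∞)×ℝ^d)`)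
of `D_t u = A(t)u` on `(s,∞)×ℝ^d` with `u(s,·) = f`. -/
structure IsBoundedClassicalSolution {d : ℕ} (q : ℝ → Ed d → Matrix (Fin d) (Fin d) ℝ)
    (b : ℝ → Ed d → Ed d) (s : ℝ) (f : Ed d → ℝ) (u : ℝ → Ed d → ℝ) : Prop where
  cont : ContinuousOn (fun z : ℝ × Ed d => u z.1 z.2) (Ici s ×ˢ (univ : Set (Ed d)))
  bdd : ∃ M, ∀ t ∈ Ici s, ∀ x, |u t x| ≤ M
  smooth_space : ∀ t ∈ Ioi s, ContDiff ℝ 2 (u t)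
  pde : ∀ t ∈ Ioi s, ∀ x, HasDerivAt (fun τ => u τ x) (applyA q b t (u t) x) t
  init : ∀ x, u s x = f x

/-- Hypotheses (H), together with the associated evolution operator `G(t,s)`. -/
structure Hypotheses (d : ℕ) where
  /-- the Hölder exponent -/
  α : ℝ
  hα : α ∈ Ioo (0:ℝ) 1
  /-- the diffusion coefficients -/
  q : ℝ → Ed d → Matrix (Fin d) (Fin d) ℝ
  /-- the drift coefficients -/
  b : ℝ → Ed d → Ed d
  /-- the ellipticity function -/
  η : ℝ → Ed d → ℝ
  η₀ : ℝ
  -- (i): local regularity `C^{α/2,1+α}_loc`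
  q_diff : ∀ t ∈ Ici (0:ℝ), ∀ i j, Differentiable ℝ fun x => q t x i j
  b_diff : ∀ t ∈ Ici (0:ℝ), Differentiable ℝ (b t)
  q_locHolder : ∀ i j, ∀ T > (0:ℝ), ∀ R > (0:ℝ), ∃ L : ℝ,
    ∀ t ∈ Icc (0:ℝ) T, ∀ s ∈ Icc (0:ℝ) T,
      ∀ x ∈ closedBall (0 : Ed d) R, ∀ y ∈ closedBall (0 : Ed d) R,
        |q t x i j - q s y i j| ≤ L * (|t - s| ^ (α/2) + ‖x - y‖ ^ α) ∧
        ‖gradient (fun z => q t z i j) x - gradient (fun z => q s z i j) y‖ ≤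
          L * (|t - s| ^ (α/2) + ‖x - y‖ ^ α)
  b_locHolder : ∀ i, ∀ T > (0:ℝ), ∀ R > (0:ℝ), ∃ L : ℝ,
    ∀ t ∈ Icc (0:ℝ) T, ∀ s ∈ Icc (0:ℝ) T,
      ∀ x ∈ closedBall (0 : Ed d) R, ∀ y ∈ closedBall (0 : Ed d) R,
        |b t x i - b s y i| ≤ L * (|t - s| ^ (α/2) + ‖x - y‖ ^ α) ∧
        ‖gradient (fun z => b t z i) x - gradient (fun z => b s z i) y‖ ≤
          L * (|t - s| ^ (α/2) + ‖x - y‖ ^ α)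
  -- (i): boundedness on `[0,∞) × B_R` and uniform-in-time `L^p(B_R)` bounds
  q_bdd : ∀ R > (0:ℝ), ∃ M : ℝ, ∀ t ∈ Ici (0:ℝ), ∀ x ∈ ball (0 : Ed d) R, ∀ i j,
    |q t x i j| ≤ M
  q_cont : ∀ R > (0:ℝ), ∀ i j, ContinuousOn (fun z : ℝ × Ed d => q z.1 z.2 i j)
    (Ici (0:ℝ) ×ˢ ball (0 : Ed d) R)
  int_bdd : ∃ p : ℝ, (d : ℝ) + 2 < p ∧ ∀ R > (0:ℝ), ∃ M : ℝ, ∀ t ∈ Ici (0:ℝ), ∀ i j : Fin d,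
    (∫ x in ball (0 : Ed d) R, ‖gradient (fun z => q t z i j) x‖ ^ p) ≤ M ∧
    (∫ x in ball (0 : Ed d) R, |b t x j| ^ p) ≤ M
  -- (ii): symmetry and ellipticity
  q_symm : ∀ t ∈ Ici (0:ℝ), ∀ x, (q t x).IsSymm
  hη₀ : 0 < η₀
  η_lb : ∀ t ∈ Ici (0:ℝ), ∀ x, η₀ ≤ η t x
  ellipticity : ∀ t ∈ Ici (0:ℝ), ∀ x, ∀ ξ : Ed d,
    η t x * ‖ξ‖ ^ 2 ≤ ∑ i, ∑ j, q t x i j * ξ i * ξ j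
  -- (iii): Lyapunov function
  V : Ed d → ℝ
  V_pos : ∀ x, 0 < V x
  V_C2 : ContDiff ℝ 2 V
  V_tendsto : Tendsto V (comap (fun x : Ed d => ‖x‖) atTop) atTop
  a : ℝ
  κ : ℝ
  ha : 0 ≤ a
  hκ : 0 < κ
  lyapunov : ∀ t ∈ Ici (0:ℝ), ∀ x, applyA q b t V x ≤ a - κ * V x
  -- (iv): bounds on the space derivatives of the coefficients
  c₀ : ℝ
  r₀ : ℝ
  hc₀ : 0 ≤ c₀
  gradQ_bdd : ∀ t ∈ Ici (0:ℝ), ∀ x,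
    Real.sqrt (∑ i, ∑ j, ‖gradient (fun z => q t z i j) x‖ ^ 2) ≤ c₀ * η t x
  b_dissip : ∀ t ∈ Ici (0:ℝ), ∀ x, ∀ ξ : Ed d, ⟪fderiv ℝ (b t) x ξ, ξ⟫ ≤ r₀ * ‖ξ‖ ^ 2
  -- (v): growth conditions
  growth : ∃ c > (0:ℝ),
    (∀ t ∈ Ici (0:ℝ), ∀ x,
        Real.sqrt (∑ i, ∑ j, (q t x i j) ^ 2) ≤ c * (1 + ‖x‖) * V x ∧
        ⟪b t x, x⟫ ≤ c * (1 + ‖x‖ ^ 2) * V x) ∨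
    (∀ t ∈ Ici (0:ℝ), ∀ x, Real.sqrt (∑ i, ∑ j, (q t x i j) ^ 2) ≤ c)
  /-- the evolution operator -/
  G : ℝ → ℝ → (Ed d → ℝ) → Ed d → ℝ
  G_sol : ∀ s ∈ Ici (0:ℝ), ∀ f, IsCb f →
    IsBoundedClassicalSolution q b s f fun t => G t s f
  G_unique : ∀ s ∈ Ici (0:ℝ), ∀ f, IsCb f → ∀ u,
    IsBoundedClassicalSolution q b s f u → ∀ t ∈ Ici s, ∀ x, u t x = G t s f x

/-- `{μ_t : t ≥ 0}` is an evolution system of measures for `G(t,s)`. -/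
def IsEvolutionSystem {d : ℕ} (H : Hypotheses d) (μ : ℝ → Measure (Ed d)) : Prop :=
  (∀ t ∈ Ici (0:ℝ), IsProbabilityMeasure (μ t)) ∧
    ∀ f, IsCb f → ∀ s ∈ Ici (0:ℝ), ∀ t ∈ Ici s,
      ∫ x, H.G t s f x ∂μ t = ∫ x, f x ∂μ s

/-- The system `{μ_t : t ≥ 0}` is tight. -/
def IsTightSystem {d : ℕ} (μ : ℝ → Measure (Ed d)) : Prop :=
  ∀ ε > (0:ℝ), ∃ R > (0:ℝ), ∀ t ∈ Ici (0:ℝ),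
    ENNReal.ofReal (1 - ε) ≤ μ t (ball (0 : Ed d) R)

lemma second_deriv_test (F F' : ℝ → ℝ) (F'' : ℝ) (hF : ∀ᶠ h in 𝓝 (0:ℝ), HasDerivAt F (F' h) h)
    (hF' : HasDerivAt F' F'' 0) (hmax : IsLocalMax F 0) : F'' ≤ 0 := by
  by_contra hpos
  push Not at hpos
  have hd : deriv F =ᶠ[𝓝 0] F' := hF.mono fun h hh => hh.deriv
  have hdd : deriv (deriv F) 0 = F'' := by rw [hd.deriv_eq, hF'.deriv]
  have hmin : IsLocalMin F 0 := isLocalMin_of_deriv_deriv_pos (by rw [hdd]; exact hpos)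
    hmax.deriv_eq_zero hF.self_of_nhds.continuousAt
  have hconst : F =ᶠ[𝓝 0] fun _ => F 0 := by
    filter_upwards [hmin, hmax] with h h1 h2 using le_antisymm h2 h1
  have h0 : deriv F =ᶠ[𝓝 0] fun _ => 0 := by
    have := hconst.deriv
    simpa using this
  have : deriv (deriv F) 0 = 0 := by rw [h0.deriv_eq]; simp
  rw [hdd] at this
  linarith

open Matrix in
lemma exists_sqrt {d : ℕ} (B : Matrix (Fin d) (Fin d) ℝ) (hB : B.IsSymm) (l : ℝ) (hl : 0 ≤ l)
    (h : ∀ v : Fin d → ℝ, l * (v ⬝ᵥ v) ≤ v ⬝ᵥ (B *ᵥ v)) :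
    ∃ T : Matrix (Fin d) (Fin d) ℝ, Tᵀ = T ∧ T * T = B ∧
      ∀ v : Fin d → ℝ, √l * (v ⬝ᵥ v) ≤ v ⬝ᵥ (T *ᵥ v) := by
  have hH : B.IsHermitian := by
    rw [Matrix.IsHermitian, Matrix.conjTranspose_eq_transpose_of_trivial]; exact hB
  set U : Matrix (Fin d) (Fin d) ℝ := (hH.eigenvectorUnitary : Matrix (Fin d) (Fin d) ℝ) with hU
  have hUU : Uᵀ * U = 1 := by
    have := Unitary.coe_star_mul_self hH.eigenvectorUnitary
    simpa [Matrix.star_eq_conjTranspose, Matrix.conjTranspose_eq_transpose_of_trivial] using this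
  have hUU' : U * Uᵀ = 1 := mul_eq_one_comm.mp hUU
  have hspec : B = U * diagonal hH.eigenvalues * Uᵀ := by
    have := hH.spectral_theorem
    simpa [Unitary.conjStarAlgAut_apply, Matrix.star_eq_conjTranspose, Function.comp_def,
      Matrix.conjTranspose_eq_transpose_of_trivial] using this
  have key : ∀ (D : Fin d → ℝ) (v : Fin d → ℝ),
      v ⬝ᵥ ((U * diagonal D * Uᵀ) *ᵥ v) = ∑ i, D i * ((Uᵀ *ᵥ v) i)^2 := by
    intro D v
    rw [← Matrix.mulVec_mulVec, ← Matrix.mulVec_mulVec, Matrix.dotProduct_mulVec,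
      ← Matrix.mulVec_transpose, dotProduct]
    refine Finset.sum_congr rfl fun i _ => ?_
    rw [Matrix.mulVec_diagonal]; ring
  have hnorm : ∀ v : Fin d → ℝ, v ⬝ᵥ v = ∑ i, ((Uᵀ *ᵥ v) i)^2 := by
    intro v
    have := key (fun _ => 1) v
    simp only [Matrix.diagonal_one, Matrix.mul_one, hUU', Matrix.one_mulVec, one_mul] at this
    exact this
  have hev : ∀ i, l ≤ hH.eigenvalues i := by
    intro i
    have h1 := h (U *ᵥ Pi.single i 1)
    rw [hnorm, hspec, key] at h1
    simp only [Matrix.mulVec_mulVec, hUU, Matrix.one_mulVec] at h1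
    simpa [Pi.single_apply] using h1
  refine ⟨U * diagonal (fun i => √(hH.eigenvalues i)) * Uᵀ, ?_, ?_, ?_⟩
  · simp [Matrix.transpose_mul, Matrix.mul_assoc]
  · calc _ = U * diagonal (fun i => √(hH.eigenvalues i)) * (Uᵀ * U) *
        diagonal (fun i => √(hH.eigenvalues i)) * Uᵀ := by simp only [Matrix.mul_assoc]
      _ = B := by
        conv_rhs => rw [hspec]
        rw [hUU, Matrix.mul_one, Matrix.mul_assoc U, Matrix.diagonal_mul_diagonal]
        congr 3
        ext i
        exact Real.mul_self_sqrt (hl.trans (hev i))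
  · intro v
    rw [key, hnorm, Finset.mul_sum]
    exact Finset.sum_le_sum fun i _ =>
      mul_le_mul_of_nonneg_right (Real.sqrt_le_sqrt (hev i)) (sq_nonneg _)

open Matrix in
lemma exists_coupling {d : ℕ} (A B : Matrix (Fin d) (Fin d) ℝ) (hA : A.IsSymm) (hB : B.IsSymm)
    (l D : ℝ) (hl : 0 < l) (hD : 0 ≤ D)
    (hA0 : ∀ v : Fin d → ℝ, 0 ≤ v ⬝ᵥ (A *ᵥ v))
    (hBl : ∀ v : Fin d → ℝ, l * (v ⬝ᵥ v) ≤ v ⬝ᵥ (B *ᵥ v))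
    (hAB : ∑ i, ∑ j, (A i j - B i j)^2 ≤ D^2) (e : Fin d → ℝ) (he : e ⬝ᵥ e = 1) :
    ∃ S T : Matrix (Fin d) (Fin d) ℝ, S * Sᵀ = A ∧ T * Tᵀ = B ∧
      l ≤ ∑ k, (∑ i, (S i k - T i k) * e i)^2 ∧
      ∑ k, ∑ i, (S i k - T i k)^2 - ∑ k, (∑ i, (S i k - T i k) * e i)^2 ≤ D^2 / l := by
  obtain ⟨S, hS, hSS, hSp⟩ := exists_sqrt A hA 0 le_rfl (by simpa using hA0)
  obtain ⟨T, hT, hTT, hTp⟩ := exists_sqrt B hB l hl.le hBl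
  simp only [Real.sqrt_zero, zero_mul] at hSp
  set X := S - T with hX
  have hXt : Xᵀ = X := by rw [hX, Matrix.transpose_sub, hS, hT]
  set N := ∑ k, ∑ i, (X i k)^2 with hN
  have hN0 : 0 ≤ N := Finset.sum_nonneg fun _ _ => Finset.sum_nonneg fun _ _ => sq_nonneg _
  -- trace identities
  have htr : ∀ P : Matrix (Fin d) (Fin d) ℝ,
      trace (Xᵀ * P * X) = ∑ k, (fun i => X i k) ⬝ᵥ (P *ᵥ fun i => X i k) := by
    intro P
    rw [trace]
    refine Finset.sum_congr rfl fun k _ => ?_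
    rw [Matrix.diag_apply, Matrix.mul_assoc, Matrix.mul_apply]
    rfl
  have h1 : 0 ≤ trace (Xᵀ * S * X) := by
    rw [htr]; exact Finset.sum_nonneg fun k _ => hSp _
  have h2 : √l * N ≤ trace (Xᵀ * T * X) := by
    rw [htr, hN, Finset.mul_sum]
    refine Finset.sum_le_sum fun k _ => ?_
    refine le_trans (le_of_eq ?_) (hTp _)
    congr 1
    simp [dotProduct, sq]
  have h3 : trace (Xᵀ * S * X) + trace (Xᵀ * T * X) = ∑ k, ∑ i, X i k * (A i k - B i k) := by
    have : A - B = S * X + X * T := by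
      rw [← hSS, ← hTT, hX]; noncomm_ring
    have e1 : trace (Xᵀ * (A - B)) = trace (Xᵀ * S * X) + trace (Xᵀ * T * X) := by
      rw [this, Matrix.mul_add, Matrix.trace_add, Matrix.mul_assoc]
      congr 1
      rw [hXt, ← Matrix.mul_assoc, Matrix.trace_mul_comm, ← Matrix.mul_assoc,
        Matrix.trace_mul_comm, ← Matrix.mul_assoc]
    rw [← e1, trace]
    refine Finset.sum_congr rfl fun k _ => ?_
    rw [Matrix.diag_apply, Matrix.mul_apply]
    rfl
  have h4 : (∑ k, ∑ i, X i k * (A i k - B i k))^2 ≤ N * D^2 := by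
    have := Finset.sum_mul_sq_le_sq_mul_sq (Finset.univ : Finset (Fin d × Fin d))
      (fun z => X z.2 z.1) (fun z => A z.2 z.1 - B z.2 z.1)
    simp only [Fintype.sum_prod_type] at this
    refine this.trans (mul_le_mul_of_nonneg_left ?_ hN0)
    rw [Finset.sum_comm]; exact hAB
  have hNb : N ≤ D^2 / l := by
    have h5 : √l * N ≤ ∑ k, ∑ i, X i k * (A i k - B i k) := by linarith
    have h6 : (√l * N)^2 ≤ N * D^2 :=
      (pow_le_pow_left₀ (by positivity) h5 2).trans h4
    rw [mul_pow, Real.sq_sqrt hl.le] at h6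
    rw [le_div_iff₀ hl]
    rcases hN0.eq_or_lt with h0 | h0
    · rw [← h0, zero_mul]; positivity
    · exact le_of_mul_le_mul_left (by linarith) h0
  -- invert T
  have hTinj : Function.Injective T.mulVec := by
    rw [← Matrix.coe_mulVecLin, ← LinearMap.ker_eq_bot, LinearMap.ker_eq_bot']
    intro v hv
    have := hTp v
    rw [← Matrix.mulVecLin_apply, hv, dotProduct_zero] at this
    have hv0 : v ⬝ᵥ v ≤ 0 := by
      by_contra hc
      push Not at hc
      have := mul_pos (Real.sqrt_pos.mpr hl) hc
      linarith
    have hv1 : 0 ≤ v ⬝ᵥ v := Finset.sum_nonneg fun i _ => mul_self_nonneg _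
    exact dotProduct_self_eq_zero.mp (le_antisymm hv0 hv1)
  obtain ⟨w, hw⟩ : ∃ w, T *ᵥ w = e := by
    have : Function.Surjective T.mulVecLin :=
      LinearMap.surjective_of_injective (by rw [Matrix.coe_mulVecLin]; exact hTinj)
    exact this e
  set n2 := w ⬝ᵥ w with hn2
  have hn2pos : 0 < n2 := by
    rcases (Finset.sum_nonneg fun i _ => mul_self_nonneg (w i) : 0 ≤ w ⬝ᵥ w).eq_or_lt with h | h
    · have : w = 0 := dotProduct_self_eq_zero.mp h.symm
      rw [this, Matrix.mulVec_zero] at hw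
      rw [← hw] at he; simp at he
    · exact h
  have hn2l : l * n2 ≤ 1 := by
    have := hBl w
    rw [← hTT, ← Matrix.mulVec_mulVec, hw, Matrix.dotProduct_mulVec, ← Matrix.mulVec_transpose,
      hT, hw, he] at this
    exact this
  -- reflection
  set R : Matrix (Fin d) (Fin d) ℝ := 1 - (2 / n2) • vecMulVec w w with hR
  have hRt : Rᵀ = R := by
    rw [hR, Matrix.transpose_sub, Matrix.transpose_smul, Matrix.transpose_one,
      Matrix.transpose_vecMulVec]
  have hRR : R * R = 1 := by
    have hvv : vecMulVec w w * vecMulVec w w = n2 • vecMulVec w w := by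
      rw [Matrix.vecMulVec_mul_vecMulVec]
      ext i j; simp [vecMulVec_apply, hn2]; ring
    rw [hR, Matrix.sub_mul, Matrix.mul_sub, Matrix.mul_sub, Matrix.one_mul, Matrix.mul_one,
      Matrix.smul_mul, Matrix.mul_smul, Matrix.mul_smul, hvv, smul_smul, smul_smul]
    have : 2 / n2 * (2 / n2) * n2 = 2 / n2 + 2 / n2 := by field_simp; norm_num
    rw [this, add_smul, Matrix.one_mul]
    abel
  have hTR : ∀ i k, (T * R) i k = T i k - (2 / n2) * e i * w k := by
    intro i k
    rw [hR, Matrix.mul_sub, Matrix.mul_one, Matrix.mul_smul, Matrix.mul_vecMulVec, hw]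
    simp [vecMulVec_apply]; ring
  set p : Fin d → ℝ := fun k => ∑ i, X i k * e i with hp
  have he' : ∑ i, e i * e i = 1 := he
  have hn2' : ∑ k, w k * w k = n2 := rfl
  have hpe : ∀ k, ∑ i, (S i k - (T * R) i k) * e i = p k + (2 / n2) * w k := by
    intro k
    simp only [hTR, hp, hX, Matrix.sub_apply]
    rw [← mul_one (2 / n2 * w k), ← he', Finset.mul_sum, ← Finset.sum_add_distrib]
    refine Finset.sum_congr rfl fun i _ => ?_
    ring
  have hperp : ∀ k, ∑ i, (S i k - (T * R) i k)^2 =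
      ∑ i, (X i k)^2 - (p k)^2 + (p k + (2 / n2) * w k)^2 := by
    intro k
    have : ∀ i, (S i k - (T * R) i k)^2 = (X i k)^2 + 2 * (2 / n2) * w k * (X i k * e i)
        + (2 / n2 * w k)^2 * (e i * e i) := by
      intro i; rw [hTR, hX, Matrix.sub_apply]; ring
    simp only [this, Finset.sum_add_distrib, ← Finset.mul_sum, he']
    simp only [hp]
    ring
  by_cases hc : l ≤ ∑ k, (p k)^2
  · refine ⟨S, T, by rw [hS, hSS], by rw [hT, hTT], hc, ?_⟩
    have : 0 ≤ ∑ k, (p k)^2 := Finset.sum_nonneg fun _ _ => sq_nonneg _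
    change N - ∑ k, (p k)^2 ≤ _
    linarith
  · refine ⟨S, T * R, by rw [hS, hSS], ?_, ?_, ?_⟩
    · rw [Matrix.transpose_mul, hRt, hT, Matrix.mul_assoc, ← Matrix.mul_assoc R, hRR,
        Matrix.one_mul, hTT]
    · simp only [hpe]
      push Not at hc
      -- one of the two couplings has a large radial part
      have hs : ∑ k, (2 * ((1 / n2)^2 * (w k * w k))) ≤
          ∑ k, ((p k)^2 + (p k + (2 / n2) * w k)^2) := by
        refine Finset.sum_le_sum fun k _ => ?_
        have : (2 / n2) = 2 * (1 / n2) := by ring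
        rw [this]
        nlinarith [sq_nonneg (p k + 1 / n2 * w k)]
      rw [← Finset.mul_sum, ← Finset.mul_sum, hn2', Finset.sum_add_distrib] at hs
      have h7 : l ≤ (1 / n2)^2 * n2 := by
        have : (1 / n2)^2 * n2 = 1 / n2 := by field_simp
        rw [this, le_div_iff₀ hn2pos]; exact hn2l
      linarith
    · simp only [hpe, hperp, Finset.sum_add_distrib, Finset.sum_sub_distrib]
      have : 0 ≤ ∑ k, (p k)^2 := Finset.sum_nonneg fun _ _ => sq_nonneg _
      change N - _ + _ - _ ≤ _
      linarith

lemma q_seg_deriv {d : ℕ} (H : Hypotheses d) {t : ℝ} (ht : 0 ≤ t) (x y : Ed d)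
    (C : Fin d → Fin d → ℝ) (τ : ℝ) :
    ∃ D, HasDerivAt (fun τ : ℝ => ∑ i, ∑ j, C i j * H.q t (y + τ • (x - y)) i j) D τ ∧
      |D| ≤ √(∑ i, ∑ j, (C i j)^2) * (‖x - y‖ * (H.c₀ * H.η t (y + τ • (x - y)))) := by
  set z := y + τ • (x - y) with hz
  refine ⟨∑ i, ∑ j, C i j * ⟪gradient (fun w => H.q t w i j) z, x - y⟫, ?_, ?_⟩
  · refine HasDerivAt.fun_sum fun i _ => HasDerivAt.fun_sum fun j _ => ?_
    refine HasDerivAt.const_mul _ ?_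
    have h1 : HasFDerivAt (fun w => H.q t w i j) (fderiv ℝ (fun w => H.q t w i j) z) z :=
      (H.q_diff t ht i j z).hasFDerivAt
    have h2 : HasDerivAt (fun τ : ℝ => y + τ • (x - y)) (x - y) τ := by
      simpa using ((hasDerivAt_id τ).smul_const (x - y)).const_add y
    have h3 := h1.comp_hasDerivAt τ h2
    have h4 : ⟪gradient (fun w => H.q t w i j) z, x - y⟫ =
      fderiv ℝ (fun w => H.q t w i j) z (x - y) := by
      simp [gradient]
    rw [h4]; exact h3
  · set g : Fin d → Fin d → ℝ := fun i j => ‖gradient (fun w => H.q t w i j) z‖ with hg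
    have h1 : |∑ i, ∑ j, C i j * ⟪gradient (fun w => H.q t w i j) z, x - y⟫| ≤
        ∑ i, ∑ j, (|C i j| * g i j) * ‖x - y‖ := by
      refine (Finset.abs_sum_le_sum_abs _ _).trans (Finset.sum_le_sum fun i _ => ?_)
      refine (Finset.abs_sum_le_sum_abs _ _).trans (Finset.sum_le_sum fun j _ => ?_)
      rw [abs_mul, mul_assoc]
      exact mul_le_mul_of_nonneg_left (abs_real_inner_le_norm _ _) (abs_nonneg _)
    have h2 : ∑ i, ∑ j, (|C i j| * g i j) ≤ √(∑ i, ∑ j, (C i j)^2) * √(∑ i, ∑ j, (g i j)^2) := by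
      have := Real.sum_mul_le_sqrt_mul_sqrt (Finset.univ : Finset (Fin d × Fin d))
        (fun z => |C z.1 z.2|) (fun z => g z.1 z.2)
      simpa only [Fintype.sum_prod_type, sq_abs] using this
    simp only [← Finset.sum_mul] at h1
    refine h1.trans ?_
    have h3 := H.gradQ_bdd t ht z
    calc _ ≤ (√(∑ i, ∑ j, (C i j)^2) * √(∑ i, ∑ j, (g i j)^2)) * ‖x - y‖ := by gcongr
      _ ≤ (√(∑ i, ∑ j, (C i j)^2) * (H.c₀ * H.η t z)) * ‖x - y‖ := by gcongr
      _ = _ := by ring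

open Matrix in
lemma q_quad {d : ℕ} (M : Matrix (Fin d) (Fin d) ℝ) (v : Fin d → ℝ) :
    v ⬝ᵥ (M *ᵥ v) = ∑ i, ∑ j, M i j * v i * v j := by
  simp only [dotProduct, mulVec, Finset.mul_sum]
  refine Finset.sum_congr rfl fun i _ => Finset.sum_congr rfl fun j _ => by ring

open Matrix in
lemma q_lip {d : ℕ} (H : Hypotheses d) {t : ℝ} (ht : 0 ≤ t) {x y : Ed d} (hxy : x ≠ y) :
    ∃ l, H.η₀ ≤ l ∧ (∀ v : Fin d → ℝ, l * (v ⬝ᵥ v) ≤ v ⬝ᵥ (H.q t y *ᵥ v)) ∧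
      ∑ i, ∑ j, (H.q t x i j - H.q t y i j)^2 ≤
        (H.c₀ * ‖x - y‖ * Real.exp (H.c₀ * ‖x - y‖) * l)^2 := by
  set r := ‖x - y‖ with hr
  have hr0 : 0 < r := norm_pos_iff.mpr (sub_ne_zero.mpr hxy)
  have hne : (sphere (0 : Ed d) 1).Nonempty := by
    refine ⟨r⁻¹ • (x - y), ?_⟩
    rw [mem_sphere_zero_iff_norm, norm_smul, norm_inv, Real.norm_eq_abs, abs_of_pos hr0,
      ← hr, inv_mul_cancel₀ hr0.ne']
  obtain ⟨ξ, hξ, hmin⟩ := (isCompact_sphere (0 : Ed d) 1).exists_isMinOn hne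
    (f := fun ξ : Ed d => ∑ i, ∑ j, H.q t y i j * ξ i * ξ j) (by fun_prop)
  rw [mem_sphere_zero_iff_norm] at hξ
  set l := ∑ i, ∑ j, H.q t y i j * ξ i * ξ j with hl
  have hηl : ∀ z, H.η t z ≤ ∑ i, ∑ j, H.q t z i j * ξ i * ξ j := by
    intro z
    have := H.ellipticity t ht z ξ
    rwa [hξ, one_pow, mul_one] at this
  have hl0 : H.η₀ ≤ l := (H.η_lb t ht y).trans (hηl y)
  have hξ2 : ∑ i, ξ i ^ 2 = 1 := by
    have := EuclideanSpace.real_norm_sq_eq ξ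
    rw [hξ] at this; linarith
  have hC : √(∑ i, ∑ j, (ξ i * ξ j)^2) = 1 := by
    simp only [mul_pow, ← Finset.mul_sum, hξ2, mul_one, Real.sqrt_one]
  -- Gronwall along the segment
  have hgr : ∀ τ ∈ Icc (0:ℝ) 1, H.η t (y + τ • (x - y)) ≤ Real.exp (H.c₀ * r) * l := by
    intro τ hτ
    choose D hD1 hD2 using fun τ => q_seg_deriv H ht x y (fun i j => ξ i * ξ j) τ
    set φ : ℝ → ℝ := fun τ => ∑ i, ∑ j, ξ i * ξ j * H.q t (y + τ • (x - y)) i j with hφ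
    have hφη : ∀ τ, H.η t (y + τ • (x - y)) ≤ φ τ := by
      intro τ
      refine (hηl _).trans (le_of_eq ?_)
      refine Finset.sum_congr rfl fun i _ => Finset.sum_congr rfl fun j _ => by ring
    have hφ0 : φ 0 = l := by
      simp only [hφ, zero_smul, add_zero, hl]
      refine Finset.sum_congr rfl fun i _ => Finset.sum_congr rfl fun j _ => by ring
    have hanti : AntitoneOn (fun τ => Real.exp (-(H.c₀ * r) * τ) * φ τ) (Icc 0 1) := by
      have hd : ∀ τ, HasDerivAt (fun τ => Real.exp (-(H.c₀ * r) * τ) * φ τ)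
          (Real.exp (-(H.c₀ * r) * τ) * (-(H.c₀ * r)) * φ τ +
            Real.exp (-(H.c₀ * r) * τ) * D τ) τ := by
        intro τ
        have h1 : HasDerivAt (fun τ => -(H.c₀ * r) * τ) (-(H.c₀ * r)) τ := by
          simpa using (hasDerivAt_id τ).const_mul (-(H.c₀ * r))
        exact h1.exp.mul (hD1 τ)
      refine antitoneOn_of_deriv_nonpos (convex_Icc 0 1)
        (fun τ _ => (hd τ).continuousAt.continuousWithinAt)
        (fun τ _ => (hd τ).differentiableAt.differentiableWithinAt) ?_
      intro τ _
      rw [(hd τ).deriv]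
      have h2 : D τ ≤ H.c₀ * r * φ τ := by
        have := (le_abs_self _).trans (hD2 τ)
        rw [hC, one_mul] at this
        have h3 := mul_le_mul_of_nonneg_left (hφη τ) (mul_nonneg H.hc₀ hr0.le)
        linarith
      have := mul_le_mul_of_nonneg_left h2 (Real.exp_pos (-(H.c₀ * r) * τ)).le
      linarith
    have h4 := hanti (left_mem_Icc.mpr zero_le_one) hτ hτ.1
    simp only [mul_zero, Real.exp_zero, one_mul, hφ0] at h4
    have h5 : φ τ ≤ Real.exp (H.c₀ * r * τ) * l := by
      have := mul_le_mul_of_nonneg_left h4 (Real.exp_pos (H.c₀ * r * τ)).le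
      rw [← mul_assoc, ← Real.exp_add] at this
      simpa using this
    refine (hφη τ).trans (h5.trans ?_)
    refine mul_le_mul_of_nonneg_right (Real.exp_le_exp.mpr ?_) (H.hη₀.le.trans hl0)
    exact mul_le_of_le_one_right (mul_nonneg H.hc₀ hr0.le) hτ.2
  refine ⟨l, hl0, ?_, ?_⟩
  · intro v
    rw [q_quad]
    by_cases hv : v = 0
    · simp [hv]
    set V : Ed d := WithLp.toLp 2 v with hV
    have hV0 : V ≠ 0 := by
      intro h; apply hv; ext i
      have := congrArg (fun w : Ed d => w i) h
      simpa [hV] using this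
    have hn : 0 < ‖V‖ := norm_pos_iff.mpr hV0
    have hm : (‖V‖⁻¹ • V) ∈ sphere (0 : Ed d) 1 := by
      rw [mem_sphere_zero_iff_norm, norm_smul, norm_inv, norm_norm, inv_mul_cancel₀ hn.ne']
    have h1 : l ≤ _ := hmin hm
    have h2 : ∑ i, ∑ j, H.q t y i j * (‖V‖⁻¹ • V) i * (‖V‖⁻¹ • V) j =
        (‖V‖⁻¹)^2 * ∑ i, ∑ j, H.q t y i j * v i * v j := by
      simp only [Finset.mul_sum]
      refine Finset.sum_congr rfl fun i _ => Finset.sum_congr rfl fun j _ => ?_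
      simp [hV]; ring
    beta_reduce at h1
    rw [h2] at h1
    have h3 : v ⬝ᵥ v = ‖V‖^2 := by
      rw [EuclideanSpace.real_norm_sq_eq]
      simp [dotProduct, hV, sq]
    rw [h3]
    calc l * ‖V‖^2 ≤ ((‖V‖⁻¹)^2 * ∑ i, ∑ j, H.q t y i j * v i * v j) * ‖V‖^2 := by gcongr
      _ = _ := by field_simp
  · set C : Fin d → Fin d → ℝ := fun i j => H.q t x i j - H.q t y i j with hCdef
    set N := ∑ i, ∑ j, (C i j)^2 with hN
    have hN0 : 0 ≤ N := Finset.sum_nonneg fun _ _ => Finset.sum_nonneg fun _ _ => sq_nonneg _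
    choose D hD1 hD2 using fun τ => q_seg_deriv H ht x y C τ
    obtain ⟨τ, hτ, hτe⟩ := exists_hasDerivAt_eq_slope
      (fun τ : ℝ => ∑ i, ∑ j, C i j * H.q t (y + τ • (x - y)) i j) D zero_lt_one
      (fun τ _ => (hD1 τ).continuousAt.continuousWithinAt) (fun τ _ => hD1 τ)
    have h1 : D τ = N := by
      rw [hτe]
      simp only [one_smul, zero_smul, add_zero, sub_zero, div_one, add_sub_cancel, hN,
        ← Finset.sum_sub_distrib]
      refine Finset.sum_congr rfl fun i _ => Finset.sum_congr rfl fun j _ => ?_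
      simp only [hCdef]; ring
    have h2 : N ≤ √N * (H.c₀ * r * Real.exp (H.c₀ * r) * l) := by
      have := (le_abs_self _).trans (hD2 τ)
      rw [h1] at this
      refine this.trans (mul_le_mul_of_nonneg_left ?_ (Real.sqrt_nonneg _))
      have := mul_le_mul_of_nonneg_left (hgr τ ⟨hτ.1.le, hτ.2.le⟩) (mul_nonneg hr0.le H.hc₀)
      linarith
    have h3 : √N ≤ H.c₀ * r * Real.exp (H.c₀ * r) * l := by
      rcases (Real.sqrt_nonneg N).eq_or_lt with h0 | h0
      · rw [← h0]
        have := H.hc₀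
        have := H.hη₀.le.trans hl0
        positivity
      · nth_rewrite 1 [← Real.mul_self_sqrt hN0] at h2
        exact le_of_mul_le_mul_left h2 h0
    calc N = (√N)^2 := (Real.sq_sqrt hN0).symm
      _ ≤ _ := by gcongr

lemma b_mono {d : ℕ} (H : Hypotheses d) {t : ℝ} (ht : 0 ≤ t) (x y : Ed d) :
    ⟪H.b t x - H.b t y, x - y⟫ ≤ H.r₀ * ‖x - y‖^2 := by
  have hd : ∀ τ : ℝ, HasDerivAt (fun τ : ℝ => ⟪H.b t (y + τ • (x - y)), x - y⟫)
      ⟪fderiv ℝ (H.b t) (y + τ • (x - y)) (x - y), x - y⟫ τ := by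
    intro τ
    have h1 := (H.b_diff t ht (y + τ • (x - y))).hasFDerivAt
    have h2 : HasDerivAt (fun τ : ℝ => y + τ • (x - y)) (x - y) τ := by
      simpa using ((hasDerivAt_id τ).smul_const (x - y)).const_add y
    have h3 := h1.comp_hasDerivAt τ h2
    simpa using h3.inner ℝ (hasDerivAt_const τ (x - y))
  obtain ⟨τ, hτ, hτe⟩ := exists_hasDerivAt_eq_slope _ _ zero_lt_one
      (fun τ _ => (hd τ).continuousAt.continuousWithinAt) (fun τ _ => hd τ)
  have := H.b_dissip t ht (y + τ • (x - y)) (x - y)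
  rw [hτe] at this
  simpa [inner_sub_left] using this

lemma line_hasDerivAt {d : ℕ} (x ξ : Ed d) (h : ℝ) :
    HasDerivAt (fun h : ℝ => x + h • ξ) ξ h := by
  simpa using ((hasDerivAt_id h).smul_const ξ).const_add x

lemma line_deriv1 {d : ℕ} {u : Ed d → ℝ} (hu : ContDiff ℝ 2 u) (x ξ : Ed d) (h : ℝ) :
    HasDerivAt (fun h : ℝ => u (x + h • ξ)) (fderiv ℝ u (x + h • ξ) ξ) h :=
  ((hu.differentiable (by norm_num)) _).hasFDerivAt.comp_hasDerivAt h (line_hasDerivAt x ξ h)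

lemma line_deriv2 {d : ℕ} {u : Ed d → ℝ} (hu : ContDiff ℝ 2 u) (x ξ : Ed d) :
    HasDerivAt (fun h : ℝ => fderiv ℝ u (x + h • ξ) ξ) (fderiv ℝ (fderiv ℝ u) x ξ ξ) 0 := by
  have h1 : ContDiff ℝ 1 (fderiv ℝ u) := hu.fderiv_right (by norm_num)
  have h2 : HasFDerivAt (fderiv ℝ u) (fderiv ℝ (fderiv ℝ u) x) (x + (0:ℝ) • ξ) := by
    rw [zero_smul, add_zero]
    exact ((h1.differentiable (by norm_num)) x).hasFDerivAt
  have h3 := h2.comp_hasDerivAt (0:ℝ) (line_hasDerivAt x ξ 0)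
  have h4 := h3.clm_apply (hasDerivAt_const (0:ℝ) ξ)
  simpa using h4

lemma norm_line_deriv1 {d : ℕ} (z v : Ed d) (h : ℝ) (hz : z + h • v ≠ 0) :
    HasDerivAt (fun h : ℝ => ‖z + h • v‖) (⟪z + h • v, v⟫ / ‖z + h • v‖) h := by
  have h1 : HasDerivAt (fun h : ℝ => ‖z + h • v‖^2) (2 * ⟪z + h • v, v⟫) h :=
    (line_hasDerivAt z v h).norm_sq
  have hn : 0 < ‖z + h • v‖ := norm_pos_iff.mpr hz
  have h2 := h1.sqrt (by positivity)
  simp only [Real.sqrt_sq (norm_nonneg _)] at h2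
  convert h2 using 1
  field_simp

lemma norm_line_deriv2 {d : ℕ} (z v : Ed d) (hz : z ≠ 0) :
    HasDerivAt (fun h : ℝ => ⟪z + h • v, v⟫ / ‖z + h • v‖)
      ((‖v‖^2 - (⟪z, v⟫ / ‖z‖)^2) / ‖z‖) 0 := by
  have hn : 0 < ‖z‖ := norm_pos_iff.mpr hz
  have h1 := norm_line_deriv1 z v 0 (by simpa using hz)
  have h2 : HasDerivAt (fun h : ℝ => ⟪z + h • v, v⟫) (‖v‖^2) 0 := by
    have := (line_hasDerivAt z v 0).inner ℝ (hasDerivAt_const (0:ℝ) v)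
    simpa using this
  have h3 := h2.div h1 (by simpa using hn.ne')
  simp only [zero_smul, add_zero] at h3
  refine h3.congr_deriv ?_
  field_simp

lemma exp_line_deriv {d : ℕ} (k : ℝ) (z v : Ed d) (hz : z ≠ 0) :
    ∃ E' : ℝ → ℝ, (∀ᶠ h in 𝓝 (0:ℝ),
        HasDerivAt (fun h : ℝ => 1 - Real.exp (-(k * ‖z + h • v‖))) (E' h) h) ∧
      E' 0 = k * Real.exp (-(k * ‖z‖)) * (⟪z, v⟫ / ‖z‖) ∧
      HasDerivAt E' (k * Real.exp (-(k * ‖z‖)) *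
        ((‖v‖^2 - (⟪z, v⟫ / ‖z‖)^2) / ‖z‖ - k * (⟪z, v⟫ / ‖z‖)^2)) 0 := by
  have hev : ∀ᶠ h in 𝓝 (0:ℝ), z + h • v ≠ 0 := by
    have : ContinuousAt (fun h : ℝ => z + h • v) 0 := by fun_prop
    exact this.eventually_ne (by simpa using hz)
  refine ⟨fun h => k * Real.exp (-(k * ‖z + h • v‖)) * (⟪z + h • v, v⟫ / ‖z + h • v‖), ?_, ?_, ?_⟩
  · filter_upwards [hev] with h hh
    have h1 := ((norm_line_deriv1 z v h hh).const_mul k).fun_neg.exp.const_sub 1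
    refine h1.congr_deriv ?_
    ring
  · simp
  · have h0 := norm_line_deriv1 z v 0 (by simpa using hz)
    have h1 := (((h0.const_mul k).fun_neg.exp.const_mul k)).mul (norm_line_deriv2 z v hz)
    refine h1.congr_deriv ?_
    simp only [zero_smul, add_zero]
    ring

lemma applyA_eq {d : ℕ} (q : ℝ → Ed d → Matrix (Fin d) (Fin d) ℝ) (b : ℝ → Ed d → Ed d)
    (t : ℝ) (u : Ed d → ℝ) (x : Ed d) :
    applyA q b t u x = (∑ i, ∑ j, q t x i j * fderiv ℝ (fderiv ℝ u) x
      (EuclideanSpace.single i 1) (EuclideanSpace.single j 1)) + fderiv ℝ u x (b t x) := by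
  unfold applyA
  congr 1
  · refine Finset.sum_congr rfl fun i _ => Finset.sum_congr rfl fun j _ => ?_
    rw [iteratedFDeriv_two_apply]; simp
  · rw [real_inner_comm]; simp [gradient]

/-- the `k`-th column of a matrix -/
def colE {d : ℕ} (S : Matrix (Fin d) (Fin d) ℝ) (k : Fin d) : Ed d :=
  WithLp.toLp 2 fun i => S i k

lemma colE_eq {d : ℕ} (S : Matrix (Fin d) (Fin d) ℝ) (k : Fin d) :
    colE S k = ∑ i, S i k • EuclideanSpace.single i (1:ℝ) := by
  ext j
  simp [colE, Pi.single_apply]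

lemma sum_cols {d : ℕ} (S Q : Matrix (Fin d) (Fin d) ℝ) (hS : S * S.transpose = Q)
    (B : Ed d →L[ℝ] Ed d →L[ℝ] ℝ) :
    ∑ k, B (colE S k) (colE S k) =
      ∑ i, ∑ j, Q i j * B (EuclideanSpace.single i 1) (EuclideanSpace.single j 1) := by
  have : ∀ k, B (colE S k) (colE S k) = ∑ i, ∑ j, S i k * S j k *
      B (EuclideanSpace.single i 1) (EuclideanSpace.single j 1) := by
    intro k
    rw [colE_eq]
    simp only [map_sum, map_smul, _root_.sum_apply, _root_.smul_apply,
      smul_eq_mul, Finset.mul_sum]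
    rw [Finset.sum_comm]
    refine Finset.sum_congr rfl fun i _ => Finset.sum_congr rfl fun j _ => by ring
  simp only [this]
  rw [Finset.sum_comm]
  refine Finset.sum_congr rfl fun i _ => ?_
  rw [Finset.sum_comm]
  refine Finset.sum_congr rfl fun j _ => ?_
  rw [← hS, Matrix.mul_apply, Finset.sum_mul]
  rfl

lemma local_max_ineq {d : ℕ} (H : Hypotheses d) {t : ℝ} (ht : 0 ≤ t) {U1 U2 : Ed d → ℝ}
    (h1 : ContDiff ℝ 2 U1) (h2 : ContDiff ℝ 2 U2) {x y : Ed d} (hxy : x ≠ y)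
    {c k : ℝ} (hc : 0 ≤ c) (hk : 0 ≤ k)
    (hmax : ∀ ξ ζ : Ed d, IsLocalMax (fun h : ℝ => U1 (x + h • ξ) - U2 (y + h • ζ) -
      c * (1 - Real.exp (-(k * ‖(x - y) + h • (ξ - ζ)‖)))) 0) :
    ∃ l, H.η₀ ≤ l ∧ applyA H.q H.b t U1 x - applyA H.q H.b t U2 y ≤
      c * (k * Real.exp (-(k * ‖x - y‖)) *
        (-(k * l) + H.c₀^2 * ‖x - y‖ * Real.exp (H.c₀ * ‖x - y‖)^2 * l + H.r₀ * ‖x - y‖)) := by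
  obtain ⟨l, hl0, hBl, hQ⟩ := q_lip H ht hxy
  have hl : 0 < l := H.hη₀.trans_le hl0
  set z := x - y with hz
  have hz0 : z ≠ 0 := sub_ne_zero.mpr hxy
  set r := ‖z‖ with hr
  have hr0 : 0 < r := norm_pos_iff.mpr hz0
  set e : Fin d → ℝ := fun i => z i / r with he
  have hee : e ⬝ᵥ e = 1 := by
    have := EuclideanSpace.real_norm_sq_eq z
    have h3 : e ⬝ᵥ e = (∑ i, z i ^ 2) / r^2 := by
      rw [dotProduct, Finset.sum_div]
      refine Finset.sum_congr rfl fun i _ => ?_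
      simp only [he]; field_simp
    rw [h3, ← this, ← hr]; field_simp
  have hA0 : ∀ v : Fin d → ℝ, 0 ≤ v ⬝ᵥ (H.q t x).mulVec v := by
    intro v
    rw [q_quad]
    have := H.ellipticity t ht x (WithLp.toLp 2 v)
    refine le_trans ?_ this
    have := H.hη₀.trans_le (H.η_lb t ht x)
    positivity
  obtain ⟨S, T, hS, hT, hlow, hupp⟩ := exists_coupling (H.q t x) (H.q t y) (H.q_symm t ht x)
    (H.q_symm t ht y) l (H.c₀ * r * Real.exp (H.c₀ * r) * l) hl
    (by have := H.hc₀; positivity) hA0 hBl hQ e hee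
  set K := k * Real.exp (-(k * r)) with hK
  have hK0 : 0 ≤ K := by positivity
  -- second order test
  have hsec : ∀ ξ ζ : Ed d, fderiv ℝ (fderiv ℝ U1) x ξ ξ - fderiv ℝ (fderiv ℝ U2) y ζ ζ ≤
      c * (K * ((‖ξ - ζ‖^2 - (⟪z, ξ - ζ⟫ / r)^2) / r - k * (⟪z, ξ - ζ⟫ / r)^2)) := by
    intro ξ ζ
    obtain ⟨E', hE1, -, hE2⟩ := exp_line_deriv k z (ξ - ζ) hz0
    have := second_deriv_test _ (fun h => fderiv ℝ U1 (x + h • ξ) ξ - fderiv ℝ U2 (y + h • ζ) ζ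
      - c * E' h) _ (by
        filter_upwards [hE1] with h hh
        exact ((line_deriv1 h1 x ξ h).sub (line_deriv1 h2 y ζ h)).sub (hh.const_mul c))
      (((line_deriv2 h1 x ξ).sub (line_deriv2 h2 y ζ)).sub (hE2.const_mul c)) (hmax ξ ζ)
    linarith
  -- first order test
  have hfirst : fderiv ℝ U1 x (H.b t x) - fderiv ℝ U2 y (H.b t y) =
      c * (K * (⟪z, H.b t x - H.b t y⟫ / r)) := by
    obtain ⟨E', hE1, hE0, -⟩ := exp_line_deriv k z (H.b t x - H.b t y) hz0
    have := (hmax (H.b t x) (H.b t y)).hasDerivAt_eq_zero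
      (((line_deriv1 h1 x (H.b t x) 0).sub (line_deriv1 h2 y (H.b t y) 0)).sub
        (hE1.self_of_nhds.const_mul c))
    simp only [zero_smul, add_zero, hE0] at this
    linarith
  refine ⟨l, hl0, ?_⟩
  rw [applyA_eq, applyA_eq, ← sum_cols S _ hS, ← sum_cols T _ hT]
  have hsum := Finset.sum_le_sum fun k (_ : k ∈ Finset.univ) => hsec (colE S k) (colE T k)
  rw [Finset.sum_sub_distrib, ← Finset.mul_sum, ← Finset.mul_sum, Finset.sum_sub_distrib,
    ← Finset.mul_sum, ← Finset.sum_div, Finset.sum_sub_distrib] at hsum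
  have hp : ∀ k, ⟪z, colE S k - colE T k⟫ / r = ∑ i, (S i k - T i k) * e i := by
    intro k
    rw [PiLp.inner_apply, Finset.sum_div]
    refine Finset.sum_congr rfl fun i _ => ?_
    simp [colE, he]; ring
  have hn : ∀ k, ‖colE S k - colE T k‖^2 = ∑ i, (S i k - T i k)^2 := by
    intro k
    rw [EuclideanSpace.real_norm_sq_eq]
    simp [colE]
  simp only [hp, hn] at hsum
  set P := ∑ k, (∑ i, (S i k - T i k) * e i)^2 with hP
  set F := ∑ k, ∑ i, (S i k - T i k)^2 with hF
  have hb := b_mono H ht x y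
  rw [real_inner_comm] at hb
  have hb' : ⟪z, H.b t x - H.b t y⟫ / r ≤ H.r₀ * r := by
    rw [div_le_iff₀ hr0]; rw [← hz, ← hr] at hb; linarith
  have hu' : (F - P) / r ≤ H.c₀^2 * r * Real.exp (H.c₀ * r)^2 * l := by
    rw [div_le_iff₀ hr0]
    refine hupp.trans (le_of_eq ?_)
    field_simp
  have hfin : c * (K * ((F - P) / r - k * P)) + c * (K * (⟪z, H.b t x - H.b t y⟫ / r)) ≤
      c * (K * (-(k * l) + H.c₀^2 * r * Real.exp (H.c₀ * r)^2 * l + H.r₀ * r)) := by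
    rw [← mul_add, ← mul_add]
    refine mul_le_mul_of_nonneg_left (mul_le_mul_of_nonneg_left ?_ hK0) hc
    have := mul_le_mul_of_nonneg_left hlow hk
    linarith
  linarith

lemma applyA_add {d : ℕ} (q : ℝ → Ed d → Matrix (Fin d) (Fin d) ℝ) (b : ℝ → Ed d → Ed d)
    (t : ℝ) {u v : Ed d → ℝ} (hu : ContDiff ℝ 2 u) (hv : ContDiff ℝ 2 v) (m : ℝ) (x : Ed d) :
    applyA q b t (fun x => u x + m * v x) x = applyA q b t u x + m * applyA q b t v x := by
  have hu1 : Differentiable ℝ u := hu.differentiable (by norm_num)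
  have hv1 : Differentiable ℝ v := hv.differentiable (by norm_num)
  have hu2 : Differentiable ℝ (fderiv ℝ u) :=
    (hu.fderiv_right (m := 1) (by norm_num)).differentiable (by norm_num)
  have hv2 : Differentiable ℝ (fderiv ℝ v) :=
    (hv.fderiv_right (m := 1) (by norm_num)).differentiable (by norm_num)
  have e1 : fderiv ℝ (fun x => u x + m * v x) = fun x => fderiv ℝ u x + m • fderiv ℝ v x := by
    ext1 z
    exact ((hu1 z).hasFDerivAt.add ((hv1 z).hasFDerivAt.const_mul m)).fderiv
  have e2 : fderiv ℝ (fderiv ℝ (fun x => u x + m * v x)) x =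
      fderiv ℝ (fderiv ℝ u) x + m • fderiv ℝ (fderiv ℝ v) x := by
    rw [e1]
    exact ((hu2 x).hasFDerivAt.add ((hv2 x).hasFDerivAt.const_smul m)).fderiv
  rw [applyA_eq, applyA_eq, applyA_eq, e2, e1]
  simp only [_root_.add_apply, _root_.smul_apply, smul_eq_mul, mul_add, Finset.sum_add_distrib,
    Finset.mul_sum]
  have : ∀ i j, q t x i j * (m * fderiv ℝ (fderiv ℝ v) x (EuclideanSpace.single i 1)
      (EuclideanSpace.single j 1)) = m * (q t x i j * fderiv ℝ (fderiv ℝ v) x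
        (EuclideanSpace.single i 1) (EuclideanSpace.single j 1)) := fun i j => by ring
  simp only [this]
  ring

lemma V_large {d : ℕ} (H : Hypotheses d) (K : ℝ) : ∃ R > (0:ℝ), ∀ x, R ≤ ‖x‖ → K ≤ H.V x := by
  have h := H.V_tendsto.eventually (eventually_ge_atTop K)
  rw [eventually_comap] at h
  obtain ⟨R, hR⟩ := eventually_atTop.mp h
  exact ⟨max R 1, by positivity, fun x hx => hR ‖x‖ ((le_max_left _ _).trans hx) x rfl⟩

/-- properties of the constants used for the contraction estimate -/
structure GoodConst {d : ℕ} (H : Hypotheses d) (k r1 ε ω : ℝ) : Prop where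
  hk : 0 < k
  hr1 : 0 < r1
  hε : 0 < ε
  hω : 0 < ω
  near : ∀ r l W : ℝ, 0 < r → r < r1 → H.η₀ ≤ l → 0 < W →
    k * Real.exp (-(k * r)) *
        (-(k * l) + H.c₀^2 * r * Real.exp (H.c₀ * r)^2 * l + H.r₀ * r) + ε * (2 * H.a - H.κ * W) <
      -(ω * (1 - Real.exp (-(k * r)) + ε * W))
  far : ∀ x y : Ed d, r1 ≤ ‖x - y‖ → ε * (2 * H.a - H.κ * (H.V x + H.V y)) <
      -(ω * (1 - Real.exp (-(k * r1)) + ε * (H.V x + H.V y)))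

lemma exists_goodConst {d : ℕ} (H : Hypotheses d) : ∃ k r1 ε ω, GoodConst H k r1 ε ω := by
  have ha := H.ha
  have hκ := H.hκ
  have hη := H.hη₀
  have hc := H.hc₀
  obtain ⟨R, hR0, hR⟩ := V_large H (4 * H.a / H.κ + 1)
  set r1 := 2 * R with hr1
  have hr1p : 0 < r1 := by positivity
  set B1 := H.c₀^2 * r1 * Real.exp (H.c₀ * r1)^2 with hB1
  set B2 := |H.r₀| * r1 / H.η₀ with hB2
  have hB10 : 0 ≤ B1 := by positivity
  have hB20 : 0 ≤ B2 := by positivity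
  set k := B1 + B2 + 1 with hk
  have hk0 : 0 < k := by positivity
  set β := k * Real.exp (-(k * r1)) with hβ
  have hβ0 : 0 < β := by positivity
  set ε := H.η₀ * β / (4 * H.a + 1) with hε
  have hε0 : 0 < ε := by positivity
  set ω := min (H.η₀ * β / 4) (min (H.κ / 2) (ε * H.κ / 4)) with hω
  have hω0 : 0 < ω := by rw [hω]; positivity
  have hω1 : ω ≤ H.η₀ * β / 4 := min_le_left _ _
  have hω2 : ω ≤ H.κ / 2 := (min_le_right _ _).trans (min_le_left _ _)
  have hω3 : ω ≤ ε * H.κ / 4 := (min_le_right _ _).trans (min_le_right _ _)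
  have hεa : ε * (2 * H.a) ≤ H.η₀ * β / 2 := by
    rw [hε, div_mul_eq_mul_div, div_le_div_iff₀ (by positivity) (by positivity)]
    have : 0 < H.η₀ * β := by positivity
    nlinarith
  have hηβ : 0 < H.η₀ * β := by positivity
  refine ⟨k, r1, ε, ω, hk0, hr1p, hε0, hω0, ?_, ?_⟩
  · intro r l W hr hrr hl hW
    have hl0 : 0 < l := hη.trans_le hl
    have h1 : H.c₀^2 * r * Real.exp (H.c₀ * r)^2 * l ≤ B1 * l := by
      rw [hB1]; gcongr
    have h2 : H.r₀ * r ≤ B2 * l := by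
      calc H.r₀ * r ≤ |H.r₀| * r := by gcongr; exact le_abs_self _
        _ ≤ |H.r₀| * r1 := by gcongr
        _ = B2 * H.η₀ := by rw [hB2]; field_simp
        _ ≤ B2 * l := by gcongr
    have h3 : -(k * l) + H.c₀^2 * r * Real.exp (H.c₀ * r)^2 * l + H.r₀ * r ≤ -H.η₀ := by
      rw [hk]; linarith
    have h4 : β ≤ k * Real.exp (-(k * r)) := by
      rw [hβ]; gcongr
    have h5 : k * Real.exp (-(k * r)) *
        (-(k * l) + H.c₀^2 * r * Real.exp (H.c₀ * r)^2 * l + H.r₀ * r) ≤ -(β * H.η₀) := by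
      calc _ ≤ k * Real.exp (-(k * r)) * (-H.η₀) := by gcongr
        _ ≤ _ := by
          have := mul_le_mul_of_nonneg_right h4 hη.le
          linarith
    have h6 : ω * (1 - Real.exp (-(k * r))) ≤ ω :=
      mul_le_of_le_one_right hω0.le (by linarith [Real.exp_pos (-(k * r))])
    have h7 : ω * (ε * W) ≤ H.κ / 2 * (ε * W) := by gcongr
    have h8 : 0 < H.κ * (ε * W) := by positivity
    linarith
  · intro x y hxy
    have hW : 4 * H.a / H.κ + 1 ≤ H.V x + H.V y := by
      have hn := norm_sub_le x y
      by_cases hx : R ≤ ‖x‖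
      · linarith [hR x hx, H.V_pos y]
      · have : R ≤ ‖y‖ := by push Not at hx; linarith
        linarith [hR y this, H.V_pos x]
    set W := H.V x + H.V y
    have hW1 : 4 * H.a + H.κ ≤ H.κ * W := by
      have := mul_le_mul_of_nonneg_left hW hκ.le
      rw [mul_add, mul_div_cancel₀ _ hκ.ne', mul_one] at this
      exact this
    have hW0 : 0 < W := add_pos (H.V_pos x) (H.V_pos y)
    have h6 : ω * (1 - Real.exp (-(k * r1))) ≤ ω :=
      mul_le_of_le_one_right hω0.le (by linarith [Real.exp_pos (-(k * r1))])
    have h7 : ω * (ε * W) ≤ H.κ / 2 * (ε * W) := by gcongr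
    have h8 := mul_le_mul_of_nonneg_left hW1 hε0.le
    have h9 : 0 < ε * H.κ := by positivity
    linarith

lemma left_deriv_nonneg {F : ℝ → ℝ} {F' a b : ℝ} (hab : a < b) (hF : HasDerivAt F F' b)
    (h : ∀ τ ∈ Icc a b, F τ ≤ F b) : 0 ≤ F' := by
  have h1 : Tendsto (slope F b) (𝓝[<] b) (𝓝 F') :=
    (hasDerivAt_iff_tendsto_slope.mp hF).mono_left (nhdsWithin_mono _ fun x hx => ne_of_lt hx)
  refine ge_of_tendsto h1 ?_
  filter_upwards [Ioo_mem_nhdsLT hab] with τ hτ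
  rw [slope_def_field]
  exact div_nonneg_of_nonpos (by linarith [h τ ⟨hτ.1.le, hτ.2.le⟩]) (by linarith [hτ.2])

/-- the contraction weight -/
def psi {d : ℕ} (H : Hypotheses d) (k r1 ε : ℝ) (x y : Ed d) : ℝ :=
  1 - Real.exp (-(k * min ‖x - y‖ r1)) + ε * (H.V x + H.V y)

lemma psi_ge {d : ℕ} {H : Hypotheses d} {k r1 ε ω : ℝ} (hg : GoodConst H k r1 ε ω) (x y : Ed d) :
    ε * (H.V x + H.V y) ≤ psi H k r1 ε x y := by
  have : Real.exp (-(k * min ‖x - y‖ r1)) ≤ 1 := by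
    rw [Real.exp_le_one_iff, neg_nonpos]
    exact mul_nonneg hg.hk.le (le_min (norm_nonneg _) hg.hr1.le)
  unfold psi; linarith

lemma psi_pos {d : ℕ} {H : Hypotheses d} {k r1 ε ω : ℝ} (hg : GoodConst H k r1 ε ω) (x y : Ed d) :
    0 < psi H k r1 ε x y :=
  lt_of_lt_of_le (mul_pos hg.hε (add_pos (H.V_pos x) (H.V_pos y))) (psi_ge hg x y)

/-- at a spatial maximum point, the operator contracts -/
lemma space_ineq {d : ℕ} {H : Hypotheses d} {k r1 ε ω : ℝ} (hg : GoodConst H k r1 ε ω)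
    {t : ℝ} (ht : 0 ≤ t) {u : Ed d → ℝ} (hu : ContDiff ℝ 2 u) {x y : Ed d} (hxy : x ≠ y)
    {c : ℝ} (hc : 0 < c)
    (hmax : ∀ x' y', u x' - u y' - c * psi H k r1 ε x' y' ≤ u x - u y - c * psi H k r1 ε x y) :
    applyA H.q H.b t u x - applyA H.q H.b t u y < -(ω * (c * psi H k r1 ε x y)) := by
  set m := c * ε with hm
  have hm0 : 0 < m := mul_pos hc hg.hε
  have hr0 : 0 < ‖x - y‖ := norm_pos_iff.mpr (sub_ne_zero.mpr hxy)
  have hU1 : ContDiff ℝ 2 (fun z => u z + (-m) * H.V z) := hu.add (contDiff_const.mul H.V_C2)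
  have hU2 : ContDiff ℝ 2 (fun z => u z + m * H.V z) := hu.add (contDiff_const.mul H.V_C2)
  have hLx := mul_le_mul_of_nonneg_left (H.lyapunov t ht x) hm0.le
  have hLy := mul_le_mul_of_nonneg_left (H.lyapunov t ht y) hm0.le
  have hW : 0 < H.V x + H.V y := add_pos (H.V_pos x) (H.V_pos y)
  unfold psi at hmax ⊢
  have hline : ∀ (ξ ζ : Ed d) (h : ℝ), (x + h • ξ) - (y + h • ζ) = (x - y) + h • (ξ - ζ) := by
    intro ξ ζ h; rw [smul_sub]; abel
  rcases lt_or_ge ‖x - y‖ r1 with hr | hr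
  · obtain ⟨l, hl, hmain⟩ := local_max_ineq H ht hU1 hU2 hxy hc.le hg.hk.le (by
      intro ξ ζ
      have hev : ∀ᶠ h in 𝓝 (0:ℝ), ‖(x - y) + h • (ξ - ζ)‖ < r1 := by
        have : ContinuousAt (fun h : ℝ => ‖(x - y) + h • (ξ - ζ)‖) 0 := by fun_prop
        exact this.eventually_lt continuousAt_const (by simpa using hr)
      filter_upwards [hev] with h hh
      have := hmax (x + h • ξ) (y + h • ζ)
      rw [hline, min_eq_left hh.le, min_eq_left hr.le] at this
      simp only [zero_smul, add_zero]
      rw [hm]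
      linarith)
    rw [applyA_add _ _ _ hu H.V_C2, applyA_add _ _ _ hu H.V_C2] at hmain
    have hn := mul_lt_mul_of_pos_left (hg.near ‖x - y‖ l _ hr0 hr hl hW) hc
    rw [min_eq_left hr.le]
    rw [hm] at hLx hLy hmain
    linarith
  · obtain ⟨l, hl, hmain⟩ := local_max_ineq H ht hU1 hU2 hxy (c := 0) (k := 0) le_rfl le_rfl (by
      intro ξ ζ
      refine Eventually.of_forall fun h => ?_
      have := hmax (x + h • ξ) (y + h • ζ)
      rw [hline, min_eq_right hr] at this
      have h2 : c * (1 - Real.exp (-(k * min ‖x - y + h • (ξ - ζ)‖ r1))) ≤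
          c * (1 - Real.exp (-(k * r1))) := by
        have := hg.hk
        gcongr
        exact min_le_right _ _
      simp only [zero_smul, add_zero]
      rw [hm]
      linarith)
    rw [applyA_add _ _ _ hu H.V_C2, applyA_add _ _ _ hu H.V_C2] at hmain
    have hn := mul_lt_mul_of_pos_left (hg.far x y hr) hc
    rw [min_eq_right hr]
    rw [hm] at hLx hLy hmain
    linarith

lemma decay {d : ℕ} {H : Hypotheses d} {k r1 ε ω : ℝ} (hg : GoodConst H k r1 ε ω)
    {s : ℝ} (hs : 0 ≤ s) {f : Ed d → ℝ} {u : ℝ → Ed d → ℝ}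
    (hu : IsBoundedClassicalSolution H.q H.b s f u) {δ C : ℝ} (hδ : 0 ≤ δ) (hC : 0 < C)
    (hf : ∀ x y, f x - f y ≤ δ + C * psi H k r1 ε x y) :
    ∀ t ≥ s, ∀ x y, u t x - u t y ≤ δ + C * Real.exp (-(ω * (t - s))) * psi H k r1 ε x y := by
  intro t1 ht1 x1 y1
  by_contra hcon
  push Not at hcon
  obtain ⟨M, hM⟩ := hu.bdd
  have hM0 : 0 ≤ M := (abs_nonneg _).trans (hM s self_mem_Ici 0)
  set cc : ℝ → ℝ := fun t => C * Real.exp (-(ω * (t - s))) with hcc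
  have hcc0 : ∀ t, 0 < cc t := fun t => by simp only [hcc]; positivity
  set w : ℝ × Ed d × Ed d → ℝ := fun z =>
    u z.1 z.2.1 - u z.1 z.2.2 - δ - cc z.1 * psi H k r1 ε z.2.1 z.2.2 with hw
  have hw1 : 0 < w (t1, x1, y1) := by simp only [hw, hcc]; linarith
  obtain ⟨R0, -, hR0⟩ := V_large H ((2 * M + 1) / (cc t1 * ε))
  have hccε : 0 < cc t1 * ε := mul_pos (hcc0 _) hg.hε
  set R := max R0 (max ‖x1‖ ‖y1‖) with hR
  set S : Set (ℝ × Ed d × Ed d) := Icc s t1 ×ˢ (closedBall 0 R ×ˢ closedBall 0 R) with hS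
  have hScomp : IsCompact S :=
    isCompact_Icc.prod ((isCompact_closedBall _ _).prod (isCompact_closedBall _ _))
  have hmem : (t1, x1, y1) ∈ S := by
    refine ⟨⟨ht1, le_rfl⟩, ?_, ?_⟩
    · rw [mem_closedBall_zero_iff]; exact (le_max_left _ _).trans (le_max_right _ _)
    · rw [mem_closedBall_zero_iff]; exact (le_max_right _ _).trans (le_max_right _ _)
  have hVc : Continuous H.V := H.V_C2.continuous
  have hwc : ContinuousOn w S := by
    have c1 : ContinuousOn (fun z : ℝ × Ed d × Ed d => u z.1 z.2.1) S :=
      hu.cont.comp (f := fun z : ℝ × Ed d × Ed d => (z.1, z.2.1)) (by fun_prop)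
        (fun z hz => ⟨hz.1.1, mem_univ _⟩)
    have c2 : ContinuousOn (fun z : ℝ × Ed d × Ed d => u z.1 z.2.2) S :=
      hu.cont.comp (f := fun z : ℝ × Ed d × Ed d => (z.1, z.2.2)) (by fun_prop)
        (fun z hz => ⟨hz.1.1, mem_univ _⟩)
    have c3 : Continuous (fun z : ℝ × Ed d × Ed d => cc z.1 * psi H k r1 ε z.2.1 z.2.2) := by
      simp only [hcc, psi]; fun_prop
    exact ((c1.sub c2).sub continuousOn_const).sub c3.continuousOn
  obtain ⟨⟨ts, x, y⟩, hzS, hzmax⟩ := hScomp.exists_isMaxOn ⟨_, hmem⟩ hwc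
  have hpos : 0 < w (ts, x, y) := hw1.trans_le (hzmax hmem)
  obtain ⟨hts1, hts2⟩ : s ≤ ts ∧ ts ≤ t1 := hzS.1
  have hglob : ∀ t ∈ Icc s t1, ∀ x' y', w (t, x', y') ≤ w (ts, x, y) := by
    intro t ht x' y'
    by_cases hin : x' ∈ closedBall (0 : Ed d) R ∧ y' ∈ closedBall (0 : Ed d) R
    · exact hzmax (show (t, x', y') ∈ S from ⟨ht, hin.1, hin.2⟩)
    · refine le_trans ?_ hpos.le
      have hV : (2 * M + 1) / (cc t1 * ε) ≤ H.V x' + H.V y' := by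
        rw [not_and_or, mem_closedBall_zero_iff, mem_closedBall_zero_iff] at hin
        rcases hin with h | h
        · linarith [hR0 x' ((le_max_left _ _).trans (not_le.mp h).le), H.V_pos y']
        · linarith [hR0 y' ((le_max_left _ _).trans (not_le.mp h).le), H.V_pos x']
      rw [div_le_iff₀ hccε] at hV
      have hcle : cc t1 ≤ cc t := by
        have := hg.hω
        have := ht.2
        simp only [hcc]
        gcongr
      have h1 : cc t1 * (ε * (H.V x' + H.V y')) ≤ cc t * psi H k r1 ε x' y' :=
        mul_le_mul hcle (psi_ge hg x' y')
          (mul_pos hg.hε (add_pos (H.V_pos _) (H.V_pos _))).le (hcc0 t).le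
      have h2 := abs_le.mp (hM t ht.1 x')
      have h3 := abs_le.mp (hM t ht.1 y')
      simp only [hw]
      linarith
  have hxy : x ≠ y := by
    rintro rfl
    have := mul_pos (hcc0 ts) (psi_pos hg x x)
    simp only [hw] at hpos
    linarith
  have htss : s < ts := by
    rcases hts1.eq_or_lt with h | h
    · exfalso
      subst h
      have := hf x y
      simp only [hw, hcc, hu.init, sub_self, mul_zero, neg_zero, Real.exp_zero, mul_one] at hpos
      linarith
    · exact h
  -- space
  have hspace := space_ineq hg (hs.trans hts1) (hu.smooth_space ts htss) hxy (hcc0 ts) (by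
    intro x' y'
    have := hglob ts ⟨hts1, hts2⟩ x' y'
    simp only [hw] at this
    linarith)
  -- time
  have hccd : HasDerivAt cc (-(ω * cc ts)) ts := by
    have h1 : HasDerivAt (fun t => -(ω * (t - s))) (-(ω * 1)) ts :=
      (((hasDerivAt_id ts).sub_const s).const_mul ω).fun_neg
    refine (h1.exp.const_mul C).congr_deriv ?_
    simp only [hcc]; ring
  have hder : HasDerivAt (fun t => w (t, x, y))
      (applyA H.q H.b ts (u ts) x - applyA H.q H.b ts (u ts) y -
        -(ω * cc ts) * psi H k r1 ε x y) ts :=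
    (((hu.pde ts htss x).sub (hu.pde ts htss y)).sub_const δ).sub (hccd.mul_const (psi H k r1 ε x y))
  have htime := left_deriv_nonneg htss hder (fun τ hτ => hglob τ ⟨hτ.1, hτ.2.trans hts2⟩ x y)
  linarith

lemma init_est {d : ℕ} {H : Hypotheses d} {k r1 ε ω : ℝ} (hg : GoodConst H k r1 ε ω)
    {f : Ed d → ℝ} (hf : IsCb f) {δ : ℝ} (hδ : 0 < δ) :
    ∃ C > 0, ∀ x y, f x - f y ≤ δ + C * psi H k r1 ε x y := by
  obtain ⟨hfc, M, hM⟩ := hf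
  have hM0 : 0 ≤ M := (abs_nonneg _).trans (hM 0)
  obtain ⟨R, hR0, hR⟩ := V_large H 1
  have huc : UniformContinuousOn f (closedBall 0 R) :=
    (isCompact_closedBall _ _).uniformContinuousOn_of_continuous hfc.continuousOn
  obtain ⟨ρ, hρ, hρf⟩ := Metric.uniformContinuousOn_iff.mp huc δ hδ
  set g0 := 1 - Real.exp (-(k * min ρ r1)) with hg0
  have hg0p : 0 < g0 := by
    have : 0 < min ρ r1 := lt_min hρ hg.hr1
    have : Real.exp (-(k * min ρ r1)) < 1 := by
      rw [Real.exp_lt_one_iff, neg_lt_zero]; exact mul_pos hg.hk this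
    linarith
  set C := (2 * M + 1) / g0 + (2 * M + 1) / ε with hC
  have hε := hg.hε
  have hC1 : 2 * M + 1 ≤ C * g0 := by
    have : C * g0 = (2 * M + 1) + (2 * M + 1) / ε * g0 := by rw [hC]; field_simp
    rw [this]
    have : 0 ≤ (2 * M + 1) / ε * g0 := by positivity
    linarith
  have hC2 : 2 * M + 1 ≤ C * ε := by
    have : C * ε = (2 * M + 1) + (2 * M + 1) / g0 * ε := by rw [hC]; field_simp; ring
    rw [this]
    have : 0 ≤ (2 * M + 1) / g0 * ε := by positivity
    linarith
  have hC0 : 0 < C := by rw [hC]; positivity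
  refine ⟨C, hC0, fun x y => ?_⟩
  have hψ := mul_pos hC0 (psi_pos hg x y)
  have hb : f x - f y ≤ 2 * M := by linarith [abs_le.mp (hM x), abs_le.mp (hM y)]
  by_cases hin : x ∈ closedBall (0 : Ed d) R ∧ y ∈ closedBall (0 : Ed d) R
  · rcases lt_or_ge ‖x - y‖ ρ with h | h
    · have := hρf x hin.1 y hin.2 (by rwa [dist_eq_norm])
      rw [Real.dist_eq] at this
      linarith [(abs_lt.mp this).2]
    · have h1 : g0 ≤ psi H k r1 ε x y := by
        have h2 : Real.exp (-(k * min ‖x - y‖ r1)) ≤ Real.exp (-(k * min ρ r1)) := by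
          have := hg.hk
          gcongr
        have := mul_pos hε (add_pos (H.V_pos x) (H.V_pos y))
        unfold psi; linarith
      have := mul_le_mul_of_nonneg_left h1 hC0.le
      linarith
  · have hV : 1 ≤ H.V x + H.V y := by
      rw [not_and_or, mem_closedBall_zero_iff, mem_closedBall_zero_iff] at hin
      rcases hin with h | h
      · linarith [hR x (not_le.mp h).le, H.V_pos y]
      · linarith [hR y (not_le.mp h).le, H.V_pos x]
    have h1 : ε ≤ psi H k r1 ε x y := (le_mul_of_one_le_right hε.le hV).trans (psi_ge hg x y)
    have := mul_le_mul_of_nonneg_left h1 hC0.le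
    linarith

/-- local uniform decay of the oscillation -/
lemma osc_decay {d : ℕ} (H : Hypotheses d) {s : ℝ} (hs : 0 ≤ s) {f : Ed d → ℝ} (hf : IsCb f)
    {u : ℝ → Ed d → ℝ} (hu : IsBoundedClassicalSolution H.q H.b s f u) {δ : ℝ} (hδ : 0 < δ)
    (R : ℝ) : ∀ᶠ t in atTop, ∀ x ∈ ball (0 : Ed d) R, ∀ y ∈ ball (0 : Ed d) R,
      |u t x - u t y| ≤ 2 * δ := by
  obtain ⟨k, r1, ε, ω, hg⟩ := exists_goodConst H
  obtain ⟨C, hC, hCf⟩ := init_est hg hf hδ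
  have hdec := decay hg hs hu hδ.le hC hCf
  obtain ⟨Vm, hVm⟩ := (isCompact_closedBall (0 : Ed d) R).exists_bound_of_continuousOn
    H.V_C2.continuous.continuousOn
  have hψ : ∀ x ∈ ball (0 : Ed d) R, ∀ y ∈ ball (0 : Ed d) R,
      psi H k r1 ε x y ≤ 1 + ε * (Vm + Vm) := by
    intro x hx y hy
    have h1 := (le_abs_self _).trans (hVm x (ball_subset_closedBall hx))
    have h2 := (le_abs_self _).trans (hVm y (ball_subset_closedBall hy))
    have h3 := mul_le_mul_of_nonneg_left (add_le_add h1 h2) hg.hε.le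
    have := Real.exp_pos (-(k * min ‖x - y‖ r1))
    unfold psi; linarith
  have hlim : Tendsto (fun t => C * Real.exp (-(ω * (t - s))) * (1 + ε * (Vm + Vm)))
      atTop (𝓝 0) := by
    have h1 : Tendsto (fun t : ℝ => ω * (t - s)) atTop atTop :=
      (tendsto_atTop_add_const_right _ (-s) tendsto_id).const_mul_atTop hg.hω
    have h2 := Real.tendsto_exp_neg_atTop_nhds_zero.comp h1
    simpa using (h2.const_mul C).mul_const (1 + ε * (Vm + Vm))
  filter_upwards [hlim.eventually_le_const hδ, eventually_ge_atTop s] with t ht hts x hx y hy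
  have hc0 : 0 ≤ C * Real.exp (-(ω * (t - s))) := by positivity
  rw [abs_le]
  have h1 := hdec t hts x y
  have h2 := hdec t hts y x
  have h3 := mul_le_mul_of_nonneg_left (hψ x hx y hy) hc0
  have h4 := mul_le_mul_of_nonneg_left (hψ y hy x hx) hc0
  constructor <;> linarith

lemma integral_osc {d : ℕ} (ν : Measure (Ed d)) [IsProbabilityMeasure ν] {v : Ed d → ℝ}
    (hv : Continuous v) {M δ θ R : ℝ} (hM : ∀ x, |v x| ≤ M) (hδ : 0 ≤ δ)
    (hR : ENNReal.ofReal (1 - θ) ≤ ν (ball (0 : Ed d) R))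
    (hosc : ∀ x ∈ ball (0 : Ed d) R, ∀ y ∈ ball (0 : Ed d) R, |v x - v y| ≤ δ) :
    ∫ x, |v x - ∫ y, v y ∂ν| ∂ν ≤ δ + 4 * M * θ := by
  have hM0 : 0 ≤ M := (abs_nonneg _).trans (hM 0)
  set B := (ball (0 : Ed d) R)ᶜ with hB
  have hBm : MeasurableSet B := measurableSet_ball.compl
  have hθ : ν.real B ≤ θ := by
    rw [hB, measureReal_compl measurableSet_ball, probReal_univ]
    have := (ENNReal.ofReal_le_iff_le_toReal (measure_ne_top _ _)).mp hR
    change 1 - θ ≤ ν.real _ at this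
    linarith
  set I : Ed d → ℝ := B.indicator (fun _ => 2 * M) with hI
  have hIi : Integrable I ν := (integrable_const _).indicator hBm
  have hI0 : ∀ x, 0 ≤ I x := fun x => indicator_nonneg (fun _ _ => by positivity) x
  have hIint : ∫ x, I x ∂ν ≤ 2 * M * θ := by
    rw [hI, integral_indicator_const _ hBm, smul_eq_mul, mul_comm]
    gcongr
  have hvi : Integrable v ν :=
    Integrable.of_bound hv.aestronglyMeasurable M (Eventually.of_forall hM)
  have hpt : ∀ x y, |v x - v y| ≤ δ + I x + I y := by
    intro x y
    have h2M : |v x - v y| ≤ 2 * M := by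
      rw [abs_le]
      have := abs_le.mp (hM x)
      have := abs_le.mp (hM y)
      constructor <;> linarith
    by_cases hx : x ∈ ball (0 : Ed d) R
    · by_cases hy : y ∈ ball (0 : Ed d) R
      · linarith [hosc x hx y hy, hI0 x, hI0 y]
      · have : I y = 2 * M := indicator_of_mem (show y ∈ B from hy) _
        linarith [hI0 x]
    · have : I x = 2 * M := indicator_of_mem (show x ∈ B from hx) _
      linarith [hI0 y]
  have h1 : ∀ x, |v x - ∫ y, v y ∂ν| ≤ δ + I x + 2 * M * θ := by
    intro x
    have e1 : v x - ∫ y, v y ∂ν = ∫ y, (v x - v y) ∂ν := by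
      rw [integral_sub (integrable_const _) hvi]; simp
    rw [e1]
    refine (abs_integral_le_integral_abs).trans ?_
    calc ∫ y, |v x - v y| ∂ν ≤ ∫ y, (δ + I x + I y) ∂ν :=
          integral_mono ((integrable_const _).sub hvi).abs ((integrable_const _).add hIi) (hpt x)
      _ = δ + I x + ∫ y, I y ∂ν := by
          rw [integral_add (integrable_const _) hIi]; simp
      _ ≤ _ := by linarith
  calc ∫ x, |v x - ∫ y, v y ∂ν| ∂ν ≤ ∫ x, ((δ + 2 * M * θ) + I x) ∂ν :=
        integral_mono (hvi.sub (integrable_const _)).abs ((integrable_const _).add hIi)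
          (fun x => by have := h1 x; beta_reduce; linarith)
    _ = (δ + 2 * M * θ) + ∫ x, I x ∂ν := by
        rw [integral_add (integrable_const _) hIi]; simp
    _ ≤ _ := by linarith

/-- For every `s ≥ 0`, `p ∈ [1,∞)` and `f ∈ C_b(ℝ^d)`,
`∫ |G(t,s)f − m_s(f)|^p dμ_t → 0` as `t → +∞`. -/
theorem strong_convergence_in_Lp (d : ℕ) (H : Hypotheses d) (μ : ℝ → Measure (Ed d))
    (hsys : IsEvolutionSystem H μ) (htight : IsTightSystem μ)
    (s : ℝ) (hs : 0 ≤ s) (p : ℝ) (hp : 1 ≤ p) (f : Ed d → ℝ) (hf : IsCb f) :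
    Tendsto (fun t => ∫ x, |H.G t s f x - ∫ y, f y ∂μ s| ^ p ∂μ t) atTop (𝓝 0) := by

  have hu := H.G_sol s hs f hf
  obtain ⟨M, hM⟩ := hu.bdd
  have hM0 : 0 ≤ M := (abs_nonneg _).trans (hM s self_mem_Ici 0)
  have hcont : ∀ t ≥ s, Continuous (H.G t s f) := by
    intro t ht
    have := hu.cont.comp_continuous (f := fun x : Ed d => (t, x)) (by fun_prop)
      (fun x => ⟨ht, mem_univ _⟩)
    exact this
  set m := ∫ y, f y ∂μ s with hm
  -- the case of exponent one
  have hone : Tendsto (fun t => ∫ x, |H.G t s f x - m| ∂μ t) atTop (𝓝 0) := by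
    rw [Metric.tendsto_nhds]
    intro ε hε
    set δ := ε / 8 with hδ
    have hδ0 : 0 < δ := by positivity
    obtain ⟨R, -, hR⟩ := htight (δ / (M + 1)) (by positivity)
    filter_upwards [osc_decay H hs hf hu hδ0 R, eventually_ge_atTop s] with t hosc ht
    have ht0 : (0:ℝ) ≤ t := hs.trans ht
    haveI := hsys.1 t ht0
    have h1 := integral_osc (μ t) (hcont t ht) (hM t ht) (by positivity) (hR t ht0) hosc
    rw [hsys.2 f hf s hs t ht, ← hm] at h1
    have h2 : 4 * M * (δ / (M + 1)) ≤ 4 * δ := by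
      have : M * (δ / (M + 1)) ≤ δ := by
        rw [← mul_div_assoc, div_le_iff₀ (by positivity)]
        nlinarith
      linarith
    rw [Real.dist_0_eq_abs, abs_of_nonneg (integral_nonneg fun x => abs_nonneg _)]
    linarith
  have hbound : Tendsto (fun t => (2 * M) ^ (p - 1) * ∫ x, |H.G t s f x - m| ∂μ t) atTop (𝓝 0) := by
    simpa using hone.const_mul ((2 * M) ^ (p - 1))
  refine squeeze_zero' (Eventually.of_forall fun t => integral_nonneg fun x => by positivity) ?_
    hbound
  filter_upwards [eventually_ge_atTop s] with t ht
  have ht0 : (0:ℝ) ≤ t := hs.trans ht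
  haveI := hsys.1 t ht0
  have hGi : Integrable (H.G t s f) (μ t) :=
    Integrable.of_bound (hcont t ht).aestronglyMeasurable M (Eventually.of_forall (hM t ht))
  have hmM : |m| ≤ M := by
    rw [hm, ← hsys.2 f hf s hs t ht]
    have := norm_integral_le_of_norm_le_const (μ := μ t) (f := H.G t s f)
      (Eventually.of_forall (hM t ht))
    simpa using this
  have hd : ∀ x, |H.G t s f x - m| ≤ 2 * M := by
    intro x
    have h1 := abs_le.mp (hM t ht x)
    have h2 := abs_le.mp hmM
    beta_reduce at h1
    rw [abs_le]
    constructor <;> linarith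
  rw [← integral_const_mul]
  refine integral_mono_of_nonneg (Eventually.of_forall fun x => by positivity)
    ((hGi.sub (integrable_const _)).abs.const_mul _) (Eventually.of_forall fun x => ?_)
  beta_reduce
  have h0 := abs_nonneg (H.G t s f x - m)
  calc |H.G t s f x - m| ^ p = |H.G t s f x - m| ^ ((p - 1) + 1) := by ring_nf
    _ = |H.G t s f x - m| ^ (p - 1) * |H.G t s f x - m| := by
      rw [Real.rpow_add_of_nonneg h0 (by linarith) zero_le_one, Real.rpow_one]
    _ ≤ _ := by
      refine mul_le_mul_of_nonneg_right ?_ h0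
      exact Real.rpow_le_rpow h0 (hd x) (by linarith)
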